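/- arXiv:math/0502354 — 3 statements merged into one kernel-verified Lean document; each statement's English description precedes it below -/
import Mathlib

section
/- Let (a_1,…,a_n) be a finite sequence of positive integers and let ω = [a_1,…,a_n,1,1,1,…] be the irrational number whose continued fraction digits begin with a_1,…,a_n and are 1 thereafter. Then for every ε > 0 there exist an integer m > 0 and a positive integer N such that the number β = [a_1,…,a_n,1,1,…,1,N,1,1,…], whose continued fraction digits agree with those of ω except that the digit in position n+m equals N, satisfies Φ(ω) + ε < Φ(β) < Φ(ω) + 2ε. -/
open scoped Real ENNReal
open Filter

/-- The Gauss-map iterates: `alphaIter θ k` is `α_{k+1}(θ)`, i.e. `alphaIter θ 0 = α_1(θ) = θ`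
and `α_{i+1}(θ)` is the fractional part of `1/α_i(θ)`. -/
noncomputable def alphaIter (θ : ℝ) : ℕ → ℝ
  | 0 => θ
  | k + 1 => Int.fract (1 / alphaIter θ k)

/-- `HasCF θ a` : `θ` is an irrational number in `(0,1)` whose continued fraction digits
are given by `a` (0-indexed: `a k` is the digit `a_{k+1}` in 1-indexed notation). -/
def HasCF (θ : ℝ) (a : ℕ → ℕ) : Prop :=
  θ ∈ Set.Ioo (0 : ℝ) 1 ∧ Irrational θ ∧ ∀ k, ⌊1 / alphaIter θ k⌋ = (a k : ℤ)

/-- Yoccoz's Brjuno function `Φ(θ) = Σ_{n≥1} α_1(θ)⋯α_{n-1}(θ)·log(1/α_n(θ))`,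
as a real-valued sum. -/
noncomputable def brjunoPhi (θ : ℝ) : ℝ :=
  ∑' k : ℕ, (∏ j ∈ Finset.range k, alphaIter θ j) * Real.log (1 / alphaIter θ k)

/-- Yoccoz's Brjuno function with values in `ℝ≥0∞` (all terms are nonnegative). -/
noncomputable def brjunoPhiE (θ : ℝ) : ℝ≥0∞ :=
  ∑' k : ℕ, ENNReal.ofReal ((∏ j ∈ Finset.range k, alphaIter θ j) * Real.log (1 / alphaIter θ k))

/-- Digits of the noble number `ω = [a_1,…,a_n,1,1,1,…]`. -/
def nobleDigits (n : ℕ) (a : ℕ → ℕ) : ℕ → ℕ := fun k => if k < n then a k else 1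

/-- Digits of `β^N = [a_1,…,a_n,1,…,1,N,1,1,…]`, with `N` in (1-indexed) position `n+m`. -/
def betaDigits (n m N : ℕ) (a : ℕ → ℕ) : ℕ → ℕ :=
  fun k => if k + 1 = n + m then N else if k < n then a k else 1

/-- Digits of `β^I = [a_1,…,a_n,1,…,1,b_{n+m},b_{n+m+1},…]`: the digits of the noble number
with the whole tail from (1-indexed) position `n+m` on replaced by the tail `b`. -/
def tailDigits (n m : ℕ) (a b : ℕ → ℕ) : ℕ → ℕ :=
  fun k => if k + 1 < n + m then (if k < n then a k else 1) else b k

namespace HasCF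

variable {θ : ℝ} {a : ℕ → ℕ}

lemma irrational_alphaIter (h : HasCF θ a) (k : ℕ) : Irrational (alphaIter θ k) := by
  induction k with
  | zero => exact h.2.1
  | succ k ih =>
    have h1 : Irrational (1 / alphaIter θ k) := by rw [one_div]; exact ih.inv
    exact h1.sub_intCast _

lemma alphaIter_mem (h : HasCF θ a) (k : ℕ) : 0 < alphaIter θ k ∧ alphaIter θ k < 1 := by
  cases k with
  | zero => exact h.1
  | succ k =>
    have h0 := (h.irrational_alphaIter (k + 1)).ne_zero
    exact ⟨lt_of_le_of_ne (Int.fract_nonneg _) h0.symm, Int.fract_lt_one _⟩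

lemma one_div_alphaIter (h : HasCF θ a) (k : ℕ) :
    1 / alphaIter θ k = a k + alphaIter θ (k + 1) := by
  have h1 := Int.floor_add_fract (1 / alphaIter θ k)
  rw [h.2.2 k] at h1
  rw [← h1]
  simp [alphaIter]

lemma alphaIter_mul (h : HasCF θ a) (k : ℕ) :
    alphaIter θ k * (a k + alphaIter θ (k + 1)) = 1 := by
  rw [← h.one_div_alphaIter k, mul_one_div_cancel (h.alphaIter_mem k).1.ne']

lemma one_le_digit (h : HasCF θ a) (k : ℕ) : 1 ≤ a k := by
  by_contra! hk
  have h1 := h.alphaIter_mul k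
  have h2 := h.alphaIter_mem k
  have h3 := h.alphaIter_mem (k + 1)
  have h4 : a k = 0 := by omega
  rw [h4] at h1
  push_cast at h1
  nlinarith

lemma prod_pos (h : HasCF θ a) (k : ℕ) : 0 < ∏ j ∈ Finset.range k, alphaIter θ j :=
  Finset.prod_pos fun j _ => (h.alphaIter_mem j).1

lemma log_nonneg (h : HasCF θ a) (k : ℕ) : 0 ≤ Real.log (1 / alphaIter θ k) := by
  apply Real.log_nonneg
  rw [le_div_iff₀ (h.alphaIter_mem k).1]
  linarith [(h.alphaIter_mem k).2]

lemma log_le (h : HasCF θ a) (k : ℕ) : Real.log (1 / alphaIter θ k) ≤ Real.log (a k + 1) := by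
  have h3 := h.alphaIter_mem (k + 1)
  rw [h.one_div_alphaIter]
  apply Real.log_le_log
  · have : (0 : ℝ) ≤ a k := Nat.cast_nonneg _
    linarith
  · linarith

end HasCF

/-- Denominators of the convergents of the continued fraction with digits `a`. -/
noncomputable def cfDen (a : ℕ → ℕ) : ℕ → ℝ
  | 0 => 1
  | 1 => a 0
  | k + 2 => a (k + 1) * cfDen a (k + 1) + cfDen a k

lemma cfDen_congr {a b : ℕ → ℕ} (k : ℕ) (h : ∀ i < k, a i = b i) : cfDen a k = cfDen b k := by
  induction k using Nat.twoStepInduction with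
  | zero => rfl
  | one => simp [cfDen, h 0 zero_lt_one]
  | more k ih1 ih2 =>
    rw [cfDen, cfDen, ih1 fun i hi => h i (by omega), ih2 fun i hi => h i (by omega),
      h (k + 1) (by omega)]

lemma pow_le_two_mul_cfDen {a : ℕ → ℕ} (h : ∀ k, 1 ≤ a k) (k : ℕ) :
    (3 / 2 : ℝ) ^ k ≤ 2 * cfDen a k := by
  induction k using Nat.twoStepInduction with
  | zero => simp [cfDen]
  | one =>
    have h0 : (1 : ℝ) ≤ a 0 := by exact_mod_cast h 0
    simp only [cfDen, pow_one]
    linarith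
  | more k ih1 ih2 =>
    have h0 : (1 : ℝ) ≤ a (k + 1) := by exact_mod_cast h (k + 1)
    have hp : (0 : ℝ) < (3 / 2) ^ k := by positivity
    rw [pow_succ] at ih2
    rw [cfDen, pow_succ, pow_succ]
    nlinarith

lemma cfDen_pos {a : ℕ → ℕ} (h : ∀ k, 1 ≤ a k) (k : ℕ) : 0 < cfDen a k := by
  have h1 := pow_le_two_mul_cfDen h k
  have hp : (0 : ℝ) < (3 / 2) ^ k := by positivity
  linarith

lemma cfDen_le_succ {a : ℕ → ℕ} (h : ∀ k, 1 ≤ a k) (k : ℕ) : cfDen a k ≤ cfDen a (k + 1) := by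
  cases k with
  | zero => simpa [cfDen] using h 0
  | succ k =>
    have h0 : (1 : ℝ) ≤ a (k + 1) := by exact_mod_cast h (k + 1)
    have h1 := cfDen_pos h k
    have h2 := cfDen_pos h (k + 1)
    rw [cfDen.eq_3]
    nlinarith

namespace HasCF

variable {θ : ℝ} {a : ℕ → ℕ}

lemma prod_mul_cfDen (h : HasCF θ a) (k : ℕ) :
    (∏ j ∈ Finset.range (k + 1), alphaIter θ j) *
      (cfDen a (k + 1) + cfDen a k * alphaIter θ (k + 1)) = 1 := by
  induction k with
  | zero => simpa [cfDen] using h.alphaIter_mul 0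
  | succ k ih =>
    rw [Finset.prod_range_succ, cfDen]
    linear_combination ih + (∏ j ∈ Finset.range (k + 1), alphaIter θ j) * cfDen a (k + 1) *
      h.alphaIter_mul (k + 1)

lemma prod_le (h : HasCF θ a) (k : ℕ) :
    ∏ j ∈ Finset.range k, alphaIter θ j ≤ 1 / cfDen a k := by
  cases k with
  | zero => simp [cfDen]
  | succ k =>
    have h1 := h.prod_mul_cfDen k
    have h2 := cfDen_pos h.one_le_digit k
    have h3 := cfDen_pos h.one_le_digit (k + 1)
    have h4 := (h.alphaIter_mem (k + 1)).1
    have h5 := h.prod_pos (k + 1)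
    rw [le_div_iff₀ h3]
    nlinarith [mul_pos h5 (mul_pos h2 h4)]

lemma le_prod (h : HasCF θ a) (k : ℕ) :
    1 / cfDen a (k + 1) * (1 - alphaIter θ (k + 1)) ≤
      ∏ j ∈ Finset.range (k + 1), alphaIter θ j := by
  have h1 := h.prod_mul_cfDen k
  have h2 := cfDen_le_succ h.one_le_digit k
  have h3 := cfDen_pos h.one_le_digit (k + 1)
  have h4 := h.alphaIter_mem (k + 1)
  have h5 := h.prod_pos (k + 1)
  set P := ∏ j ∈ Finset.range (k + 1), alphaIter θ j
  set x := alphaIter θ (k + 1)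
  have h6 : 1 ≤ P * cfDen a (k + 1) * (1 + x) := by
    nlinarith [mul_nonneg (mul_pos h5 h4.1).le (sub_nonneg.2 h2)]
  rw [div_mul_eq_mul_div, one_mul, div_le_iff₀ h3]
  nlinarith [mul_pos h5 h3, mul_pos (mul_pos h5 h3) h4.1,
    mul_nonneg (sub_nonneg.2 h6) (sub_nonneg.2 h4.2.le),
    mul_nonneg (mul_pos h5 h3).le (sq_nonneg x)]

lemma prod_le_geometric (h : HasCF θ a) (k : ℕ) :
    ∏ j ∈ Finset.range k, alphaIter θ j ≤ 2 * (2 / 3 : ℝ) ^ k := by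
  refine (h.prod_le k).trans ?_
  have h1 := pow_le_two_mul_cfDen h.one_le_digit k
  rw [div_le_iff₀ (cfDen_pos h.one_le_digit k)]
  have h2 : (2 / 3 : ℝ) ^ k * (3 / 2) ^ k = 1 := by
    rw [← mul_pow]; norm_num
  have h3 : (0 : ℝ) < (2 / 3) ^ k := by positivity
  nlinarith

lemma abs_sub_le {η : ℝ} {b : ℕ → ℕ} (h : HasCF θ a) (h' : HasCF η b) (k : ℕ)
    (hab : ∀ i < k, a i = b i) :
    |θ - η| ≤ 2 * (2 / 3 : ℝ) ^ k := by
  have key : ∀ l ≤ k, |θ - η| = (∏ j ∈ Finset.range l, alphaIter θ j) *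
      (∏ j ∈ Finset.range l, alphaIter η j) * |alphaIter θ l - alphaIter η l| := by
    intro l hl
    induction l with
    | zero => simp [alphaIter]
    | succ l ih =>
      have h1 := h.alphaIter_mul l
      have h2 := h'.alphaIter_mul l
      rw [← hab l (by omega)] at h2
      have h3 : alphaIter θ l - alphaIter η l = alphaIter θ l * alphaIter η l *
          (alphaIter η (l + 1) - alphaIter θ (l + 1)) := by
        linear_combination alphaIter η l * h1 - alphaIter θ l * h2
      rw [ih (by omega), h3, abs_mul, abs_mul, abs_of_pos (h.alphaIter_mem l).1,
        abs_of_pos (h'.alphaIter_mem l).1, Finset.prod_range_succ, Finset.prod_range_succ,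
        abs_sub_comm (alphaIter η (l + 1))]
      ring
  rw [key k le_rfl]
  have h1 := h.alphaIter_mem k
  have h2 := h'.alphaIter_mem k
  have h3 : |alphaIter θ k - alphaIter η k| ≤ 1 := by
    rw [abs_le]; constructor <;> linarith
  have h4 : ∏ j ∈ Finset.range k, alphaIter η j ≤ 1 :=
    Finset.prod_le_one (fun j _ => (h'.alphaIter_mem j).1.le)
      fun j _ => (h'.alphaIter_mem j).2.le
  have h5 := h.prod_pos k
  have h6 := h'.prod_pos k
  calc _ ≤ (∏ j ∈ Finset.range k, alphaIter θ j) * 1 * 1 := by gcongr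
    _ ≤ _ := by simpa using h.prod_le_geometric k

lemma term_nonneg (h : HasCF θ a) (k : ℕ) :
    0 ≤ (∏ j ∈ Finset.range k, alphaIter θ j) * Real.log (1 / alphaIter θ k) :=
  mul_nonneg (h.prod_pos k).le (h.log_nonneg k)

lemma term_le (h : HasCF θ a) {M k : ℕ} (hM : a k ≤ M) :
    (∏ j ∈ Finset.range k, alphaIter θ j) * Real.log (1 / alphaIter θ k) ≤
      2 * (2 / 3 : ℝ) ^ k * Real.log (M + 1) := by
  have h1 : Real.log (1 / alphaIter θ k) ≤ Real.log (M + 1) :=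
    (h.log_le k).trans (Real.log_le_log (by positivity) (by gcongr))
  exact mul_le_mul (h.prod_le_geometric k) h1 (h.log_nonneg k) (by positivity)

/-- If the `(k+2)`-nd digit is `⌈exp t⌉`, its contribution to the Brjuno function is nearly
`t / cfDen a (k + 1)`. -/
lemma term_mem_of_digit_eq_ceil_exp (h : HasCF θ a) (k : ℕ) {t : ℝ} (ht : 0 ≤ t)
    (hN : a (k + 1) = ⌈Real.exp t⌉₊) :
    (∏ j ∈ Finset.range (k + 1), alphaIter θ j) * Real.log (1 / alphaIter θ (k + 1)) ∈
      Set.Icc (1 / cfDen a (k + 1) * (t - 1)) (1 / cfDen a (k + 1) * (t + 2)) := by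
  have hx := h.alphaIter_mem (k + 1)
  have hy := h.alphaIter_mem (k + 2)
  have hxy := h.one_div_alphaIter (k + 1)
  have hA : 0 < 1 / cfDen a (k + 1) := one_div_pos.2 (cfDen_pos h.one_le_digit _)
  have hc1 : Real.exp t ≤ a (k + 1) := by rw [hN]; exact Nat.le_ceil _
  have hc2 : (a (k + 1) : ℝ) < Real.exp t + 1 := by
    rw [hN]; exact Nat.ceil_lt_add_one (Real.exp_pos t).le
  have hlow : t ≤ Real.log (1 / alphaIter θ (k + 1)) := by
    rw [Real.le_log_iff_exp_le (by rw [one_div]; exact inv_pos.2 hx.1), hxy]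
    linarith
  have hup : Real.log (1 / alphaIter θ (k + 1)) ≤ t + 2 := by
    rw [Real.log_le_iff_le_exp (by rw [one_div]; exact inv_pos.2 hx.1), hxy, Real.exp_add]
    have h1 := Real.one_le_exp ht
    have h2 := Real.add_one_le_exp (2 : ℝ)
    nlinarith
  have hxlog : alphaIter θ (k + 1) * Real.log (1 / alphaIter θ (k + 1)) ≤ 1 := by
    have h1 := Real.log_le_sub_one_of_pos (one_div_pos.2 hx.1)
    have h2 : alphaIter θ (k + 1) * (1 / alphaIter θ (k + 1)) = 1 :=
      mul_one_div_cancel hx.1.ne'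
    nlinarith
  have hL := h.log_nonneg (k + 1)
  constructor
  · calc _ ≤ 1 / cfDen a (k + 1) *
          ((1 - alphaIter θ (k + 1)) * Real.log (1 / alphaIter θ (k + 1))) := by
          gcongr; linarith
      _ ≤ _ := by
          rw [← mul_assoc]; exact mul_le_mul_of_nonneg_right (h.le_prod k) hL
  · exact mul_le_mul (h.prod_le _) hup hL hA.le

end HasCF

lemma tendsto_alphaIter {θ : ℝ} {a : ℕ → ℕ} (h : HasCF θ a) {β : ℕ → ℝ} {b : ℕ → ℕ → ℕ}
    (hβ : ∀ j, HasCF (β j) (b j)) (hab : ∀ j, ∀ i < j, b j i = a i) (k : ℕ) :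
    Tendsto (fun j => alphaIter (β j) k) atTop (nhds (alphaIter θ k)) := by
  induction k with
  | zero =>
    have hg : Tendsto (fun j : ℕ => 2 * (2 / 3 : ℝ) ^ j) atTop (nhds 0) := by
      simpa using (tendsto_pow_atTop_nhds_zero_of_lt_one (by norm_num : (0 : ℝ) ≤ 2 / 3)
        (by norm_num)).const_mul 2
    rw [tendsto_iff_dist_tendsto_zero]
    exact squeeze_zero (fun _ => dist_nonneg) (fun j => (hβ j).abs_sub_le h j (hab j)) hg
  | succ k ih =>
    have h1 : Tendsto (fun j => 1 / alphaIter (β j) k - a k) atTop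
        (nhds (alphaIter θ (k + 1))) := by
      have h2 : alphaIter θ (k + 1) = 1 / alphaIter θ k - a k := by
        rw [h.one_div_alphaIter]; ring
      rw [h2]
      exact (tendsto_const_nhds.div ih (h.alphaIter_mem k).1.ne').sub_const _
    refine h1.congr' ?_
    filter_upwards [eventually_gt_atTop k] with j hj
    rw [(hβ j).one_div_alphaIter, hab j k hj]
    ring

/-- If the digits of `β j` agree with those of `θ` except at one position `p j ≥ j`, then the
Brjuno sums of `β j` without the `p j`-th term converge to that of `θ`. -/
lemma tendsto_brjunoPhi_sub {θ : ℝ} {a : ℕ → ℕ} (h : HasCF θ a) {M : ℕ} (hM : ∀ k, a k ≤ M)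
    {β : ℕ → ℝ} {b : ℕ → ℕ → ℕ} (hβ : ∀ j, HasCF (β j) (b j)) {p : ℕ → ℕ} (hp : ∀ j, j ≤ p j)
    (hab : ∀ j, ∀ i ≠ p j, b j i = a i) :
    Tendsto (fun j => brjunoPhi (β j) - (∏ i ∈ Finset.range (p j), alphaIter (β j) i) *
      Real.log (1 / alphaIter (β j) (p j))) atTop (nhds (brjunoPhi θ)) := by
  let f : ℝ → ℕ → ℝ := fun x k =>
    (∏ i ∈ Finset.range k, alphaIter x i) * Real.log (1 / alphaIter x k)
  let bd : ℕ → ℝ := fun k => 2 * (2 / 3 : ℝ) ^ k * Real.log (M + 1)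
  have hbd : Summable bd := ((summable_geometric_of_lt_one (by norm_num)
    (by norm_num)).mul_left 2).mul_right _
  have hbd0 : ∀ k, 0 ≤ bd k := fun k => by
    have : 0 ≤ Real.log (M + 1) := Real.log_nonneg (by simp)
    positivity
  have hg : ∀ j k, ‖if k = p j then 0 else f (β j) k‖ ≤ bd k := by
    intro j k
    split_ifs with hk
    · simpa using hbd0 k
    · rw [Real.norm_of_nonneg ((hβ j).term_nonneg k)]
      exact (hβ j).term_le ((hab j k hk).trans_le (hM k))
  have hsum : ∀ j, brjunoPhi (β j) - f (β j) (p j) =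
      ∑' k, if k = p j then 0 else f (β j) k := by
    intro j
    have hs : Summable (f (β j)) := by
      refine (hbd.of_norm_bounded (hg j)).congr_cofinite ?_
      filter_upwards [(Set.finite_singleton (p j)).compl_mem_cofinite] with k hk
      exact if_neg hk
    have h1 := hs.tsum_eq_add_tsum_ite (p j)
    change (∑' k, f (β j) k) - _ = _
    rw [h1]
    ring
  refine Tendsto.congr (fun j => (hsum j).symm) ?_
  refine tendsto_tsum_of_dominated_convergence hbd (g := f θ) ?_ (Eventually.of_forall hg)
  intro k
  have hα := tendsto_alphaIter h hβ fun j i hi => hab j i (by have := hp j; omega)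
  have h1 : Tendsto (fun j => f (β j) k) atTop (nhds (f θ k)) := by
    refine (tendsto_finsetProd _ fun i _ => hα i).mul (Tendsto.log ?_ ?_)
    · exact tendsto_const_nhds.div (hα k) (h.alphaIter_mem k).1.ne'
    · exact (one_div_pos.2 (h.alphaIter_mem k).1).ne'
  refine h1.congr' ?_
  filter_upwards [eventually_gt_atTop k] with j hj
  rw [if_neg (by have := hp j; omega)]

/-- Lemma `smlchg`: a single large digit far enough in the continued fraction of a noble
number raises the Brjuno function by an amount between ε and 2ε. -/
theorem brjuno_small_change
    (n : ℕ) (a : ℕ → ℕ) (ha : ∀ i < n, 0 < a i)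
    (ω : ℝ) (hω : HasCF ω (nobleDigits n a))
    (ε : ℝ) (hε : 0 < ε) :
    ∃ m N : ℕ, 0 < m ∧ 0 < N ∧
      ∀ β : ℝ, HasCF β (betaDigits n m N a) →
        brjunoPhi ω + ε < brjunoPhi β ∧ brjunoPhi β < brjunoPhi ω + 2 * ε := by
  have hd := hω.one_le_digit
  have hM : ∀ k, nobleDigits n a k ≤ 1 + ∑ i ∈ Finset.range n, a i := by
    intro k
    unfold nobleDigits
    split_ifs with hk
    · have := Finset.single_le_sum (f := a) (fun i _ => Nat.zero_le _) (Finset.mem_range.2 hk)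
      omega
    · omega
  let A : ℕ → ℝ := fun j => 1 / cfDen (nobleDigits n a) (n + j + 1)
  let t : ℕ → ℝ := fun j => 3 / 2 * ε * cfDen (nobleDigits n a) (n + j + 1)
  have hAt : ∀ j, A j * t j = 3 / 2 * ε := fun j => by
    have := (cfDen_pos hd (n + j + 1)).ne'
    simp only [A, t]
    field_simp
  have hA : Tendsto A atTop (nhds 0) := by
    have hg : Tendsto (fun j : ℕ => (3 / 2 : ℝ) ^ (n + j + 1)) atTop atTop :=
      (tendsto_pow_atTop_atTop_of_one_lt (by norm_num)).comp
        (tendsto_atTop_mono (fun j => by simp only [id]; omega) tendsto_id)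
    have hq : Tendsto (fun j => cfDen (nobleDigits n a) (n + j + 1)) atTop atTop := by
      refine tendsto_atTop_mono (fun j => ?_) (hg.const_mul_atTop (by norm_num : (0 : ℝ) < 1 / 2))
      linarith [pow_le_two_mul_cfDen hd (n + j + 1)]
    exact tendsto_const_nhds.div_atTop hq
  by_contra! hcon
  have hex : ∀ j, ∃ β, HasCF β (betaDigits n (j + 2) ⌈Real.exp (t j)⌉₊ a) ∧
      (brjunoPhi ω + ε < brjunoPhi β → brjunoPhi ω + 2 * ε ≤ brjunoPhi β) := fun j =>
    hcon (j + 2) _ (by omega) (Nat.ceil_pos.2 (Real.exp_pos _))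
  choose β hβ hbad using hex
  have hab : ∀ j, ∀ i ≠ n + j + 1,
      betaDigits n (j + 2) ⌈Real.exp (t j)⌉₊ a i = nobleDigits n a i := by
    intro j i hi
    simp only [betaDigits, nobleDigits]
    rw [if_neg (by omega)]
  have hterm : ∀ j, (∏ i ∈ Finset.range (n + j + 1), alphaIter (β j) i) *
      Real.log (1 / alphaIter (β j) (n + j + 1)) ∈
        Set.Icc (3 / 2 * ε - A j) (3 / 2 * ε + 2 * A j) := by
    intro j
    have h1 := (hβ j).term_mem_of_digit_eq_ceil_exp (n + j) (t := t j)
      (mul_pos (by positivity) (cfDen_pos hd _)).le (if_pos (by omega))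
    rw [cfDen_congr (n + j + 1) fun i hi => hab j i hi.ne] at h1
    change _ ∈ Set.Icc (A j * (t j - 1)) (A j * (t j + 2)) at h1
    rw [mul_sub, mul_add, hAt j, mul_one, mul_comm (A j) 2] at h1
    exact h1
  have hlim : Tendsto (fun j => (∏ i ∈ Finset.range (n + j + 1), alphaIter (β j) i) *
      Real.log (1 / alphaIter (β j) (n + j + 1))) atTop (nhds (3 / 2 * ε)) := by
    refine tendsto_of_tendsto_of_tendsto_of_le_of_le ?_ ?_ (fun j => (hterm j).1)
      fun j => (hterm j).2
    · simpa using hA.const_sub (3 / 2 * ε)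
    · simpa using (hA.const_mul 2).const_add (3 / 2 * ε)
  have hΦ := (tendsto_brjunoPhi_sub hω hM hβ (p := fun j => n + j + 1) (fun j => by omega)
    hab).add hlim
  simp only [sub_add_cancel] at hΦ
  obtain ⟨j, hj1, hj2⟩ := ((hΦ.eventually_const_lt
    (by linarith : brjunoPhi ω + ε < _)).and (hΦ.eventually_lt_const
    (by linarith : _ < brjunoPhi ω + 2 * ε))).exists
  exact absurd (hbad j hj1) (not_le.2 hj2)
end

section
/- Let (a_1,…,a_n) be a finite sequence of positive integers and let ω = [a_1,…,a_n,1,1,1,…]. For every ε > 0 there exists an integer m_0 > 0 such that for every m ≥ m_0 and every infinite tail of positive integers I = (b_{n+m}, b_{n+m+1}, …), the number β^I = [a_1,…,a_n,1,1,…,1,b_{n+m},b_{n+m+1},…], whose digits are a_1,…,a_n, then 1 in positions n+1 through n+m−1, and then the digits of I, satisfies Φ(β^I) > Φ(ω) − ε. -/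
open scoped Real ENNReal
open Filter

theorem alphaIter_mem_Ioo_and_irrational {θ : ℝ} (h : θ ∈ Set.Ioo (0 : ℝ) 1) (hi : Irrational θ)
    (k : ℕ) : alphaIter θ k ∈ Set.Ioo (0 : ℝ) 1 ∧ Irrational (alphaIter θ k) := by
  induction k with
  | zero => exact ⟨h, hi⟩
  | succ k ih =>
    have h1 : Irrational (Int.fract (1 / alphaIter θ k)) := by
      rw [Int.fract, one_div]
      exact ih.2.inv.sub_intCast _
    exact ⟨⟨(Int.fract_nonneg _).lt_of_ne' h1.ne_zero, Int.fract_lt_one _⟩, h1⟩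

theorem HasCF.alphaIter_pos {θ : ℝ} {d : ℕ → ℕ} (h : HasCF θ d) (k : ℕ) : 0 < alphaIter θ k :=
  (alphaIter_mem_Ioo_and_irrational h.1 h.2.1 k).1.1

theorem HasCF.alphaIter_lt_one {θ : ℝ} {d : ℕ → ℕ} (h : HasCF θ d) (k : ℕ) :
    alphaIter θ k < 1 :=
  (alphaIter_mem_Ioo_and_irrational h.1 h.2.1 k).1.2

theorem HasCF.alphaIter_mul_s1 {θ : ℝ} {d : ℕ → ℕ} (h : HasCF θ d) (k : ℕ) :
    alphaIter θ k * (d k + alphaIter θ (k + 1)) = 1 := by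
  have h1 : (d k : ℝ) + alphaIter θ (k + 1) = 1 / alphaIter θ k := by
    have h2 := Int.floor_add_fract (1 / alphaIter θ k)
    rw [h.2.2 k] at h2
    exact_mod_cast h2
  rw [h1, mul_one_div_cancel (h.alphaIter_pos k).ne']

theorem continuousAt_alphaIter {θ : ℝ} (h : θ ∈ Set.Ioo (0 : ℝ) 1) (hi : Irrational θ) (k : ℕ) :
    ContinuousAt (fun x => alphaIter x k) θ := by
  induction k with
  | zero => exact continuousAt_id
  | succ k ih =>
    obtain ⟨hk, hik⟩ := alphaIter_mem_Ioo_and_irrational h hi k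
    have hfract : ContinuousAt (Int.fract : ℝ → ℝ) (1 / alphaIter θ k) := by
      refine continuousAt_fract ?_
      rw [one_div]
      exact hik.inv.ne_int _
    exact ContinuousAt.comp (g := Int.fract) (f := fun x => 1 / alphaIter x k) hfract
      (continuousAt_const.div ih hk.1.ne')

/-- Two numbers sharing their first `N` digits differ by at most `α_1(x)⋯α_N(x)`. -/
theorem HasCF.abs_sub_le_prod {x y : ℝ} {d e : ℕ → ℕ} (hx : HasCF x d) (hy : HasCF y e) (N : ℕ)
    (hde : ∀ k < N, d k = e k) : |x - y| ≤ ∏ j ∈ Finset.range N, alphaIter x j := by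
  suffices H : |x - y| ≤ (∏ j ∈ Finset.range N, alphaIter x j) *
      |alphaIter x N - alphaIter y N| by
    refine H.trans (mul_le_of_le_one_right
      (Finset.prod_nonneg fun j _ => (hx.alphaIter_pos j).le) ?_)
    rw [abs_le]
    constructor <;> linarith [hx.alphaIter_pos N, hy.alphaIter_pos N, hx.alphaIter_lt_one N,
      hy.alphaIter_lt_one N]
  induction N with
  | zero => simp [alphaIter]
  | succ N ih =>
    refine (ih fun k hk => hde k (hk.trans N.lt_succ_self)).trans ?_
    rw [Finset.prod_range_succ, mul_assoc]
    refine mul_le_mul_of_nonneg_left ?_ (Finset.prod_nonneg fun j _ => (hx.alphaIter_pos j).le)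
    have h1 := hx.alphaIter_mul_s1 N
    have h2 := hy.alphaIter_mul_s1 N
    rw [← hde N N.lt_succ_self] at h2
    have h3 : alphaIter x N - alphaIter y N =
        -(alphaIter x N * (alphaIter x (N + 1) - alphaIter y (N + 1))) * alphaIter y N := by
      linear_combination alphaIter y N * h1 - alphaIter x N * h2
    rw [h3, abs_mul, abs_neg, abs_mul, abs_of_pos (hx.alphaIter_pos N),
      abs_of_pos (hy.alphaIter_pos N)]
    exact mul_le_of_le_one_right (mul_nonneg (hx.alphaIter_pos N).le (abs_nonneg _))
      (hy.alphaIter_lt_one N).le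

section Noble

variable {n : ℕ} {a : ℕ → ℕ} {ω : ℝ}

theorem half_le_alphaIter_of_nobleDigits (hω : HasCF ω (nobleDigits n a)) {k : ℕ} (hk : n ≤ k) :
    1 / 2 ≤ alphaIter ω k := by
  have h := hω.alphaIter_mul_s1 k
  simp only [nobleDigits, hk.not_gt, if_false, Nat.cast_one] at h
  nlinarith [hω.alphaIter_pos k, hω.alphaIter_lt_one (k + 1)]

theorem alphaIter_le_of_nobleDigits (hω : HasCF ω (nobleDigits n a)) {k : ℕ} (hk : n ≤ k) :
    alphaIter ω k ≤ 2 / 3 := by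
  have h := hω.alphaIter_mul_s1 k
  simp only [nobleDigits, hk.not_gt, if_false, Nat.cast_one] at h
  nlinarith [hω.alphaIter_pos k, half_le_alphaIter_of_nobleDigits hω (hk.trans k.le_succ)]

theorem prod_alphaIter_le_of_nobleDigits (hω : HasCF ω (nobleDigits n a)) (m : ℕ) :
    ∏ j ∈ Finset.range (m + n), alphaIter ω j ≤ (2 / 3) ^ m := by
  induction m with
  | zero =>
    simpa using Finset.prod_le_one (fun j _ => (hω.alphaIter_pos j).le)
      (fun j _ => (hω.alphaIter_lt_one j).le)
  | succ m ih =>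
    rw [Nat.add_right_comm, Finset.prod_range_succ, pow_succ]
    exact mul_le_mul ih (alphaIter_le_of_nobleDigits hω (Nat.le_add_left _ _))
      (hω.alphaIter_pos _).le (by positivity)

theorem brjunoPhiE_ne_top_of_nobleDigits (hω : HasCF ω (nobleDigits n a)) :
    brjunoPhiE ω ≠ ⊤ := by
  refine Summable.tsum_ofReal_ne_top ?_
  rw [← summable_nat_add_iff n]
  have hlog (k : ℕ) : 0 ≤ Real.log (1 / alphaIter ω k) := by
    refine Real.log_nonneg ?_
    rw [one_le_div (hω.alphaIter_pos k)]
    exact (hω.alphaIter_lt_one k).le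
  refine Summable.of_nonneg_of_le
    (fun m => mul_nonneg (Finset.prod_nonneg fun j _ => (hω.alphaIter_pos j).le) (hlog _))
    (fun m => ?_)
    ((summable_geometric_of_lt_one (r := (2 / 3 : ℝ)) (by norm_num) (by norm_num)).mul_right
      (Real.log 2))
  refine mul_le_mul (prod_alphaIter_le_of_nobleDigits hω m) ?_ (hlog _) (by positivity)
  refine Real.log_le_log (one_div_pos.2 (hω.alphaIter_pos _)) ?_
  rw [div_le_iff₀ (hω.alphaIter_pos _)]
  linarith [half_le_alphaIter_of_nobleDigits hω (Nat.le_add_left n m)]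

end Noble

theorem brjunoPhiE_pos {θ : ℝ} (h : θ ∈ Set.Ioo (0 : ℝ) 1) : 0 < brjunoPhiE θ := by
  refine lt_of_lt_of_le ?_ (ENNReal.le_tsum 0)
  simp only [Finset.range_zero, Finset.prod_empty, one_mul, alphaIter, ENNReal.ofReal_pos]
  exact Real.log_pos ((one_lt_div h.1).2 h.2)

theorem lowerSemicontinuousAt_brjunoPhiE {θ : ℝ} (h : θ ∈ Set.Ioo (0 : ℝ) 1)
    (hi : Irrational θ) : LowerSemicontinuousAt brjunoPhiE θ := by
  refine lowerSemicontinuousAt_tsum fun k => ContinuousAt.lowerSemicontinuousAt ?_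
  have hk := (alphaIter_mem_Ioo_and_irrational h hi k).1.1
  refine ENNReal.continuous_ofReal.continuousAt.comp (ContinuousAt.mul ?_ ?_)
  · exact tendsto_finsetProd _ fun j _ => continuousAt_alphaIter h hi j
  · exact (continuousAt_const.div (continuousAt_alphaIter h hi k) hk.ne').log
      (one_div_pos.2 hk).ne'

/-- Lemma `notdeclem`: replacing the tail of a noble number sufficiently far out
cannot decrease the Brjuno function by more than ε. -/
theorem brjuno_not_decreasing
    (n : ℕ) (a : ℕ → ℕ) (ha : ∀ i < n, 0 < a i)
    (ω : ℝ) (hω : HasCF ω (nobleDigits n a))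
    (ε : ℝ) (hε : 0 < ε) :
    ∃ m₀ : ℕ, 0 < m₀ ∧ ∀ m ≥ m₀, ∀ b : ℕ → ℕ, (∀ k, 0 < b k) →
      ∀ β : ℝ, HasCF β (tailDigits n m a b) →
        brjunoPhiE β > brjunoPhiE ω - ENNReal.ofReal ε := by
  have hlt : brjunoPhiE ω - ENNReal.ofReal ε < brjunoPhiE ω :=
    ENNReal.sub_lt_self (brjunoPhiE_ne_top_of_nobleDigits hω) (brjunoPhiE_pos hω.1).ne'
      (ENNReal.ofReal_pos.2 hε).ne'
  obtain ⟨δ, hδ, hball⟩ :=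
    Metric.eventually_nhds_iff.1 (lowerSemicontinuousAt_brjunoPhiE hω.1 hω.2.1 _ hlt)
  obtain ⟨M, hM⟩ := exists_pow_lt_of_lt_one hδ (show (2 / 3 : ℝ) < 1 by norm_num)
  refine ⟨M + 1, M.succ_pos, fun m hm b _ β hβ => hball ?_⟩
  obtain ⟨m, rfl⟩ : ∃ l, m = l + 1 := ⟨m - 1, by omega⟩
  rw [dist_comm, Real.dist_eq]
  calc |ω - β| ≤ ∏ j ∈ Finset.range (m + n), alphaIter ω j := by
        refine hω.abs_sub_le_prod hβ _ fun k hk => ?_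
        rw [tailDigits, if_pos (by omega), nobleDigits]
    _ ≤ (2 / 3) ^ m := prod_alphaIter_le_of_nobleDigits hω m
    _ ≤ (2 / 3) ^ M := pow_le_pow_of_le_one (by norm_num) (by norm_num) (by omega)
    _ < δ := hM
end

section
/- Fix a finite sequence of positive integers (a_1,…,a_n) and ε > 0. For all sufficiently large integers m, for every positive integer N one has Φ(β^{N+1}) − Φ(β^N) < ε. -/
open scoped Real ENNReal
open Filter

/-- `u` is the orbit under the Gauss map of a number with continued fraction digits `a`. -/
def IsGaussOrbit (u : ℕ → ℝ) (a : ℕ → ℕ) : Prop :=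
  ∀ k, 0 < u k ∧ u k < 1 ∧ u k * (a k + u (k + 1)) = 1

/-- The Brjuno sum of a sequence; on a Gauss orbit it is Yoccoz's function at its first term. -/
noncomputable def brjunoSum (u : ℕ → ℝ) : ℝ :=
  ∑' k : ℕ, (∏ j ∈ Finset.range k, u j) * Real.log (1 / u k)

theorem HasCF.isGaussOrbit {θ : ℝ} {a : ℕ → ℕ} (h : HasCF θ a) :
    IsGaussOrbit (alphaIter θ) a := by
  obtain ⟨h01, hirr, hdig⟩ := h
  have key : ∀ k, 0 < alphaIter θ k ∧ alphaIter θ k < 1 ∧ Irrational (alphaIter θ k) := by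
    intro k
    induction k with
    | zero => exact ⟨h01.1, h01.2, hirr⟩
    | succ k ih =>
      have hi : Irrational (Int.fract (1 / alphaIter θ k)) := by
        rw [one_div, Int.fract]
        exact ih.2.2.inv.sub_intCast _
      exact ⟨lt_of_le_of_ne (Int.fract_nonneg _) hi.ne_zero.symm, Int.fract_lt_one _, hi⟩
  intro k
  refine ⟨(key k).1, (key k).2.1, ?_⟩
  have hfl : (a k : ℝ) + alphaIter θ (k + 1) = 1 / alphaIter θ k := by
    have h1 : ((⌊1 / alphaIter θ k⌋ : ℤ) : ℝ) = (a k : ℝ) := by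
      rw [hdig k]
      norm_cast
    rw [← h1]
    exact Int.floor_add_fract _
  rw [hfl, mul_one_div_cancel (key k).1.ne']

namespace IsGaussOrbit

variable {u v : ℕ → ℝ} {a b : ℕ → ℕ}

theorem shift (hu : IsGaussOrbit u a) (p : ℕ) :
    IsGaussOrbit (fun k => u (k + p)) (fun k => a (k + p)) := fun k => by
  simpa only [Nat.add_right_comm k p 1] using hu (k + p)

theorem digit_pos (hu : IsGaussOrbit u a) (k : ℕ) : 1 ≤ a k := by
  by_contra h
  obtain ⟨h0, h1, h2⟩ := hu k
  have h3 : a k = 0 := by omega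
  rw [h3, Nat.cast_zero, zero_add] at h2
  nlinarith [(hu (k + 1)).1, (hu (k + 1)).2.1]

theorem mul_digit_le (hu : IsGaussOrbit u a) (k : ℕ) : u k * a k ≤ 1 := by
  nlinarith [(hu k).1, (hu k).2.2, (hu (k + 1)).1]

theorem one_div_eq (hu : IsGaussOrbit u a) (k : ℕ) : 1 / u k = a k + u (k + 1) := by
  rw [div_eq_iff (hu k).1.ne']
  linarith [(hu k).2.2]

theorem mul_succ_le_half (hu : IsGaussOrbit u a) (k : ℕ) : u k * u (k + 1) ≤ 1 / 2 := by
  have h1 : (1 : ℝ) ≤ a k := by exact_mod_cast hu.digit_pos k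
  nlinarith [(hu k).1, (hu k).2.2, (hu (k + 1)).1, (hu (k + 1)).2.1]

theorem prod_pos (hu : IsGaussOrbit u a) (k : ℕ) : 0 < ∏ j ∈ Finset.range k, u j :=
  Finset.prod_pos fun j _ => (hu j).1

theorem prod_le (hu : IsGaussOrbit u a) (k : ℕ) :
    ∏ j ∈ Finset.range k, u j ≤ 2 * (3 / 4) ^ k := by
  induction k using Nat.twoStepInduction with
  | zero => norm_num
  | one =>
    have := (hu 0).2.1
    norm_num
    linarith
  | more k ih _ =>
    rw [Finset.prod_range_succ, Finset.prod_range_succ, mul_assoc]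
    calc _ ≤ (2 * (3 / 4) ^ k) * (1 / 2 : ℝ) := by
          gcongr
          · exact (mul_pos (hu k).1 (hu (k + 1)).1).le
          · exact hu.mul_succ_le_half k
      _ ≤ 2 * (3 / 4) ^ (k + 2) := by
          have : (0 : ℝ) < (3 / 4) ^ k := by positivity
          rw [pow_add]
          linarith

theorem log_nonneg (hu : IsGaussOrbit u a) (k : ℕ) : 0 ≤ Real.log (1 / u k) :=
  Real.log_nonneg (by rw [le_div_iff₀ (hu k).1]; linarith [(hu k).2.1])

theorem term_nonneg (hu : IsGaussOrbit u a) (k : ℕ) :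
    0 ≤ (∏ j ∈ Finset.range k, u j) * Real.log (1 / u k) :=
  mul_nonneg (hu.prod_pos k).le (hu.log_nonneg k)

theorem brjunoSum_nonneg (hu : IsGaussOrbit u a) : 0 ≤ brjunoSum u :=
  tsum_nonneg hu.term_nonneg

theorem term_le (hu : IsGaussOrbit u a) {D : ℝ} (hD : ∀ k, (a k : ℝ) ≤ D) (k : ℕ) :
    (∏ j ∈ Finset.range k, u j) * Real.log (1 / u k) ≤ 2 * D * (3 / 4) ^ k := by
  have hlog : Real.log (1 / u k) ≤ D := by
    have h1 := Real.log_le_sub_one_of_pos (one_div_pos.2 (hu k).1)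
    have h2 := hu.one_div_eq k
    linarith [hD k, (hu (k + 1)).2.1]
  calc _ ≤ 2 * (3 / 4) ^ k * D :=
        mul_le_mul (hu.prod_le k) hlog (hu.log_nonneg k) (by positivity)
    _ = _ := by ring

theorem hasSum_geometric_bound (D : ℝ) : HasSum (fun k : ℕ => 2 * D * (3 / 4 : ℝ) ^ k) (8 * D) := by
  have h := (hasSum_geometric_of_lt_one (r := (3 / 4 : ℝ)) (by norm_num) (by norm_num)).mul_left
    (2 * D)
  rwa [show (1 - 3 / 4 : ℝ)⁻¹ = 4 by norm_num, show 2 * D * 4 = 8 * D by ring] at h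

theorem summable (hu : IsGaussOrbit u a) {D : ℝ} (hD : ∀ k, (a k : ℝ) ≤ D) :
    Summable fun k : ℕ => (∏ j ∈ Finset.range k, u j) * Real.log (1 / u k) :=
  Summable.of_nonneg_of_le hu.term_nonneg (hu.term_le hD) (hasSum_geometric_bound D).summable

theorem brjunoSum_le (hu : IsGaussOrbit u a) {D : ℝ} (hD : ∀ k, (a k : ℝ) ≤ D) :
    brjunoSum u ≤ 8 * D := by
  rw [← (hasSum_geometric_bound D).tsum_eq]
  exact (hu.summable hD).tsum_le_tsum (hu.term_le hD) (hasSum_geometric_bound D).summable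

/-- The functional equation `Φ(α₁) = log (1 / α₁) + α₁ Φ(α₂)`. -/
theorem brjunoSum_eq (hu : IsGaussOrbit u a) {D : ℝ} (hD : ∀ k, (a k : ℝ) ≤ D) :
    brjunoSum u = Real.log (1 / u 0) + u 0 * brjunoSum fun k => u (k + 1) := by
  rw [brjunoSum, (hu.summable hD).tsum_eq_zero_add, brjunoSum, ← tsum_mul_left]
  simp only [Finset.prod_range_succ', Finset.range_zero, Finset.prod_empty, one_mul]
  congr 1
  exact tsum_congr fun k => by ring

theorem sub_eq (hu : IsGaussOrbit u a) (hv : IsGaussOrbit v b) (hab : a 0 = b 0) :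
    u 0 - v 0 = u 0 * v 0 * (v 1 - u 1) := by
  have h1 := (hu 0).2.2
  have h2 := (hv 0).2.2
  rw [hab] at h1
  linear_combination u 0 * (-h2) + v 0 * h1

/-- Numbers sharing their first `p` digits are close. -/
theorem abs_sub_le (hu : IsGaussOrbit u a) (hv : IsGaussOrbit v b) {p : ℕ}
    (hab : ∀ k < p, a k = b k) :
    |u 0 - v 0| ≤ (∏ j ∈ Finset.range p, v j) * |u p - v p| := by
  induction p generalizing u v a b with
  | zero => simp
  | succ p ih =>
    have h := ih (hu.shift 1) (hv.shift 1) fun k hk => hab (k + 1) (by omega)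
    rw [Finset.prod_range_succ', hu.sub_eq hv (hab 0 (by omega)), abs_mul, abs_mul,
      abs_of_pos (hu 0).1, abs_of_pos (hv 0).1, abs_sub_comm (v 1)]
    have h3 : u 0 * v 0 ≤ v 0 := by nlinarith [(hu 0).2.1, (hv 0).1]
    calc _ ≤ v 0 * |u 1 - v 1| := by gcongr
      _ ≤ v 0 * _ := mul_le_mul_of_nonneg_left h (hv 0).1.le
      _ = _ := by ring

theorem log_sub_log (hu : IsGaussOrbit u a) (hv : IsGaussOrbit v b) :
    Real.log (1 / v 0) - Real.log (1 / u 0) ≤ u 0 / v 0 - 1 := by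
  rw [one_div, one_div, Real.log_inv, Real.log_inv]
  have h := Real.log_le_sub_one_of_pos (div_pos (hu 0).1 (hv 0).1)
  rw [Real.log_div (hu 0).1.ne' (hv 0).1.ne'] at h
  linarith

/-- Control of the variation of the Brjuno sum by its variation after `p` steps
of the Gauss map. -/
theorem brjunoSum_sub_le (hu : IsGaussOrbit u a) (hv : IsGaussOrbit v b) {p : ℕ}
    {D D' M C E : ℝ} (hD : ∀ k, (a k : ℝ) ≤ D) (hD' : ∀ k, (b k : ℝ) ≤ D')
    (hab : ∀ k < p, a k = b k) (hM : ∀ k < p, (b k : ℝ) ≤ M)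
    (hC : |u p - v p| * (8 * D) ≤ C)
    (hE : brjunoSum (fun k => v (k + p)) - brjunoSum (fun k => u (k + p)) ≤ E) :
    brjunoSum v - brjunoSum u ≤ (∏ j ∈ Finset.range p, v j) * (E + p * (M + 1 + C)) := by
  induction p generalizing u v a b with
  | zero => simpa using hE
  | succ p ih =>
    have ih' := ih (hu.shift 1) (hv.shift 1) (fun k => hD (k + 1)) (fun k => hD' (k + 1))
      (fun k hk => hab (k + 1) (by omega)) (fun k hk => hM (k + 1) (by omega)) hC hE
    have hd1 := (hu.shift 1).abs_sub_le (hv.shift 1) (p := p)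
      fun k hk => hab (k + 1) (by omega)
    have hd0 := hu.abs_sub_le hv hab
    have hP := (hv.shift 1).prod_pos p
    have hB := (hu.shift 1).brjunoSum_le fun k => hD (k + 1)
    have hB0 := (hu.shift 1).brjunoSum_nonneg
    rw [hu.brjunoSum_eq hD, hv.brjunoSum_eq hD']
    rw [Finset.prod_range_succ'] at hd0 ⊢
    simp only [zero_add] at hd1
    set Q := ∏ j ∈ Finset.range p, v (j + 1)
    set Bu := brjunoSum fun k => u (k + 1)
    set Bv := brjunoSum fun k => v (k + 1)
    obtain ⟨hu0, hu1, -⟩ := hu 0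
    obtain ⟨hv0, hv1, hv2⟩ := hv 0
    have habs : |u (p + 1) - v (p + 1)| ≤ 1 := by
      rw [abs_le]
      constructor <;> linarith [(hu (p + 1)).1, (hv (p + 1)).1, (hu (p + 1)).2.1,
        (hv (p + 1)).2.1]
    have hlog : Real.log (1 / v 0) - Real.log (1 / u 0) ≤ Q * v 0 * (M + 1) := by
      refine (hu.log_sub_log hv).trans ?_
      have h1 : u 0 / v 0 - 1 = u 0 * (v 1 - u 1) := by
        rw [div_sub_one hv0.ne', hu.sub_eq hv (hab 0 (by omega))]
        field_simp
      have h2 : v 1 - u 1 ≤ Q := by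
        calc v 1 - u 1 ≤ |u 1 - v 1| := by rw [abs_sub_comm]; exact le_abs_self _
          _ ≤ Q * |u (p + 1) - v (p + 1)| := hd1
          _ ≤ Q := mul_le_of_le_one_right hP.le habs
      have h3 : 1 ≤ v 0 * (M + 1) :=
        hv2.ge.trans <| mul_le_mul_of_nonneg_left
          (add_le_add (hM 0 (by omega)) (hv (0 + 1)).2.1.le) hv0.le
      rw [h1]
      nlinarith
    have hcross : (v 0 - u 0) * Bu ≤ Q * v 0 * C := by
      calc (v 0 - u 0) * Bu ≤ |u 0 - v 0| * (8 * D) := by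
            gcongr
            rw [abs_sub_comm]
            exact le_abs_self _
        _ ≤ Q * v 0 * |u (p + 1) - v (p + 1)| * (8 * D) := by
            gcongr
            exact hB0.trans hB
        _ = Q * v 0 * (|u (p + 1) - v (p + 1)| * (8 * D)) := by ring
        _ ≤ _ := by gcongr
    have hmain := mul_le_mul_of_nonneg_left ih' hv0.le
    push_cast
    linarith

end IsGaussOrbit

/-- Lemma `lem10`: for all sufficiently large `m`, `Φ(β^{N+1}) - Φ(β^N) < ε` for all `N`. -/
theorem phi_increment_small
    (n : ℕ) (a : ℕ → ℕ) (ha : ∀ i < n, 0 < a i)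
    (ε : ℝ) (hε : 0 < ε) :
    ∃ m₀ : ℕ, 0 < m₀ ∧ ∀ m ≥ m₀, ∀ N : ℕ, 0 < N →
      ∀ βN βN1 : ℝ,
        HasCF βN (betaDigits n m N a) →
        HasCF βN1 (betaDigits n m (N + 1) a) →
        brjunoPhi βN1 - brjunoPhi βN < ε := by
  set M : ℝ := 1 + ∑ i ∈ Finset.range n, (a i : ℝ) with hMdef
  have hS : 0 ≤ ∑ i ∈ Finset.range n, (a i : ℝ) := Finset.sum_nonneg fun i _ => by positivity
  have hdig : ∀ k, ((if k < n then a k else 1 : ℕ) : ℝ) ≤ M := by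
    intro k
    split_ifs with h
    · have := Finset.single_le_sum (f := fun i => (a i : ℝ)) (fun i _ => by positivity)
        (Finset.mem_range.2 h)
      linarith
    · push_cast
      linarith
  set R : ℝ := M + 1 + 8 * (M + 1)
  have hlim : Tendsto (fun p : ℕ => 2 * (3 / 4 : ℝ) ^ p * (10 + p * R)) atTop (nhds 0) := by
    have h1 := (tendsto_pow_atTop_nhds_zero_of_lt_one (r := (3 / 4 : ℝ)) (by norm_num)
      (by norm_num)).const_mul 20
    have h2 := (tendsto_self_mul_const_pow_of_lt_one (r := (3 / 4 : ℝ)) (by norm_num)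
      (by norm_num)).const_mul (2 * R)
    have h3 := h1.add h2
    rw [mul_zero, mul_zero, add_zero] at h3
    exact h3.congr fun p => by ring
  obtain ⟨p₀, hp₀⟩ := eventually_atTop.1 (hlim.eventually_lt_const hε)
  refine ⟨p₀ + 1, by omega, fun m hm N hN x y hx hy => ?_⟩
  obtain ⟨p, hp⟩ : ∃ p, n + m = p + 1 := ⟨n + m - 1, by omega⟩
  have hu := hx.isGaussOrbit
  have hv := hy.isGaussOrbit
  have hN1 : (1 : ℝ) ≤ N := by exact_mod_cast hN
  have hD : ∀ K k, (betaDigits n m K a k : ℝ) ≤ M + K := by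
    intro K k
    have hK : (0 : ℝ) ≤ K := K.cast_nonneg
    rw [betaDigits]
    split_ifs with h1 h2
    · linarith
    · have := hdig k
      rw [if_pos h2] at this
      linarith
    · push_cast
      linarith
  have hne : ∀ K k, k ≠ p → betaDigits n m K a k = if k < n then a k else 1 :=
    fun K k hk => if_neg (by omega)
  have hpd : ∀ K, betaDigits n m K a p = K := fun K => if_pos hp.symm
  have hup := hu.mul_digit_le p
  have hvp := hv.mul_digit_le p
  rw [hpd] at hup hvp
  push_cast at hvp
  have hu0 := (hu p).1
  have hv0 := (hv p).1
  have hC : |alphaIter x p - alphaIter y p| * (8 * (M + N)) ≤ 8 * (M + 1) := by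
    have h1 : |alphaIter x p - alphaIter y p| ≤ 1 / N := by
      have h2 : alphaIter x p ≤ 1 / N := by rwa [le_div_iff₀ (by linarith)]
      have h3 : alphaIter y p ≤ 1 / N := by rw [le_div_iff₀ (by linarith)]; linarith
      rw [abs_le]
      constructor <;> linarith
    calc _ ≤ 1 / (N : ℝ) * (8 * (M + N)) := by gcongr
      _ ≤ _ := by
        rw [one_div_mul_eq_div, div_le_iff₀ (by linarith)]
        nlinarith
  have hE : brjunoSum (fun k => alphaIter y (k + p)) - brjunoSum (fun k => alphaIter x (k + p))
      ≤ 10 := by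
    have hu' := hu.shift p
    have hv' := hv.shift p
    rw [hu'.brjunoSum_eq fun k => hD N (k + p), hv'.brjunoSum_eq fun k => hD (N + 1) (k + p)]
    have hlog := hu'.log_sub_log hv'
    have hBu := (hu'.shift 1).brjunoSum_nonneg
    have hBv := (hv'.shift 1).brjunoSum_le (D := 1) fun k => by
      rw [hne _ _ (by omega), if_neg (by omega)]
      simp
    have hBv0 := (hv'.shift 1).brjunoSum_nonneg
    have hratio : alphaIter x p / alphaIter y p - 1 ≤ 2 := by
      have h1 := hv.one_div_eq p
      rw [hpd] at h1
      push_cast at h1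
      rw [div_eq_mul_one_div, h1]
      nlinarith [(hu p).2.1, (hv (p + 1)).2.1]
    simp only [zero_add] at hlog ⊢
    have h4 := mul_nonneg hu0.le hBu
    have h5 := mul_le_of_le_one_left hBv0 (hv p).2.1.le
    linarith
  have hmain := hu.brjunoSum_sub_le hv (hD N) (hD (N + 1))
    (fun k hk => by rw [hne _ _ hk.ne, hne _ _ hk.ne])
    (fun k hk => by rw [hne _ _ hk.ne]; exact hdig k) hC hE
  refine lt_of_le_of_lt (hmain.trans ?_) (hp₀ p (by omega))
  have hR : 0 ≤ R := by positivity
  exact mul_le_mul_of_nonneg_right (hv.prod_le p) (by positivity)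
end
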